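/- If √n ∈ ℕ (with √n dividing n), then almost surely the binomial random graph G(n, log²n / n) contains a copy of Comb_{n,√n}. -/

import Mathlib

/- Probability that the binomial random graph `G(n,p)` satisfies the property `P`. -/
open Classical in
noncomputable def probOf (n : ℕ) (p : ℝ) (P : SimpleGraph (Fin n) → Prop) : ℝ :=
  ∑ G : SimpleGraph (Fin n),
    if P G then p ^ G.edgeSet.ncard * (1 - p) ^ (n.choose 2 - G.edgeSet.ncard) else 0

/-- `G` contains a copy of `T` (an injective graph homomorphism from `T` to `G`). -/
def ContainsCopy {V W : Type*} (T : SimpleGraph V) (G : SimpleGraph W) : Prop :=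
  ∃ f : T →g G, Function.Injective f

/-- The comb with `m·k` vertices: a spine path on the vertices `(i,0)`, `i ∈ Fin m`,
together with, for each `i`, a tooth path `(i,0),(i,1),…,(i,k-1)` of length `k-1`
beginning at the spine vertex `(i,0)`. For `k ∣ n` and `m = n/k` this is `Comb_{n,k}`. -/
def comb (m k : ℕ) : SimpleGraph (Fin m × Fin k) :=
  SimpleGraph.fromRel (fun a b =>
    ((a.2 : ℕ) = 0 ∧ (b.2 : ℕ) = 0 ∧ (b.1 : ℕ) = (a.1 : ℕ) + 1) ∨
    (a.1 = b.1 ∧ (b.2 : ℕ) = (a.2 : ℕ) + 1))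

section RandomSubset

variable {α : Type*} [DecidableEq α]

/-- The expectation of `f W`, where `W` is a random subset of `X` containing each element of `X`
independently with probability `p`. -/
noncomputable def binomExp (p : ℝ) (X : Finset α) (f : Finset α → ℝ) : ℝ :=
  ∑ W ∈ X.powerset, p ^ W.card * (1 - p) ^ (X \ W).card * f W

lemma binomExp_insert (p : ℝ) {a : α} {X : Finset α} (ha : a ∉ X) (f : Finset α → ℝ) :
    binomExp p (insert a X) f
      = (1 - p) * binomExp p X f + p * binomExp p X (fun W => f (insert a W)) := by
  unfold binomExp
  rw [Finset.sum_powerset_insert ha, Finset.mul_sum, Finset.mul_sum]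
  congr 1
  · refine Finset.sum_congr rfl fun W hW => ?_
    have haW : a ∉ W := fun h => ha (Finset.mem_powerset.1 hW h)
    rw [Finset.insert_sdiff_of_notMem _ haW,
      Finset.card_insert_of_notMem (by simp [ha]), pow_succ]
    ring
  · refine Finset.sum_congr rfl fun W hW => ?_
    have haW : a ∉ W := fun h => ha (Finset.mem_powerset.1 hW h)
    rw [Finset.card_insert_of_notMem haW, Finset.insert_sdiff_insert,
      Finset.sdiff_insert_of_notMem ha, pow_succ]
    ring

lemma binomExp_add (p : ℝ) (X : Finset α) (f g : Finset α → ℝ) :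
    binomExp p X (fun W => f W + g W) = binomExp p X f + binomExp p X g := by
  simp only [binomExp, mul_add, Finset.sum_add_distrib]

lemma binomExp_const_mul (p : ℝ) (X : Finset α) (c : ℝ) (f : Finset α → ℝ) :
    binomExp p X (fun W => c * f W) = c * binomExp p X f := by
  simp only [binomExp, Finset.mul_sum]
  exact Finset.sum_congr rfl fun W _ => by ring

lemma binomExp_const (p : ℝ) (X : Finset α) (c : ℝ) : binomExp p X (fun _ => c) = c := by
  induction X using Finset.induction_on with
  | empty => simp [binomExp]
  | insert a X ha ih => rw [binomExp_insert p ha, ih]; ring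

lemma binomExp_mono {p : ℝ} (hp₀ : 0 ≤ p) (hp₁ : p ≤ 1) {X : Finset α} {f g : Finset α → ℝ}
    (h : ∀ W ⊆ X, f W ≤ g W) : binomExp p X f ≤ binomExp p X g := by
  refine Finset.sum_le_sum fun W hW => ?_
  have := sub_nonneg.2 hp₁
  exact mul_le_mul_of_nonneg_left (h W (Finset.mem_powerset.1 hW)) (by positivity)

/-- The union of two independent binomial random subsets is a binomial random subset. -/
lemma binomExp_union (p r : ℝ) (X : Finset α) (f : Finset α → ℝ) :
    binomExp p X (fun A => binomExp r X (fun B => f (A ∪ B)))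
      = binomExp (p + r - p * r) X f := by
  induction X using Finset.induction_on generalizing f with
  | empty => simp [binomExp]
  | insert a X ha ih =>
    simp only [binomExp_insert _ ha, Finset.insert_union, Finset.union_insert,
      Finset.insert_idem, binomExp_add, binomExp_const_mul, ih,
      ih (fun W => f (insert a W))]
    ring

/-- For a family `H` and a set `W`, every `S ∈ H` contains a fragment `T` disjoint from `W` such
that `T ∪ W` contains a member of `H` and `T` lies in every member of `H` inside `T ∪ W`. -/
lemma exists_fragment (H : Finset (Finset α)) (W : Finset α) {S : Finset α} (hS : S ∈ H) :
    ∃ T ⊆ S, Disjoint T W ∧ (∃ A ∈ H, A ⊆ W ∪ T) ∧ ∀ A ∈ H, A ⊆ W ∪ T → T ⊆ A := by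
  obtain ⟨B, hB, hmin⟩ := Finset.exists_min_image (H.filter (· ⊆ W ∪ S))
    (fun A => (A \ W).card) ⟨S, by simp [hS]⟩
  simp only [Finset.mem_filter] at hB hmin
  refine ⟨B \ W, ?_, Finset.sdiff_disjoint, ⟨B, hB.1, ?_⟩, fun A hA hAB => ?_⟩
  · exact sdiff_le_iff.2 hB.2
  · simp
  · have hsub : A \ W ⊆ B \ W := sdiff_le_iff.2 hAB
    have hAS : A ⊆ W ∪ S :=
      hAB.trans (Finset.union_subset_union_right (sdiff_le_iff.2 hB.2))
    rw [← Finset.eq_of_subset_of_card_le hsub (hmin A ⟨hA, hAS⟩)]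
    exact Finset.sdiff_subset

open Classical in
/-- The large fragments of a family of small sets have small expected cost. -/
lemma binomExp_cost_le {p q : ℝ} (hq : 0 ≤ q) (hp : 0 < p) (hp₁ : p ≤ 1) (hqp : q ≤ p)
    (X : Finset α) (H : Finset (Finset α)) (m : ℕ) (hH : ∀ S ∈ H, S.card ≤ 2 * m)
    (U : Finset α → Finset (Finset α))
    (hU : ∀ W ⊆ X, ∀ T ∈ U W, T ⊆ X ∧ m ≤ T.card ∧ Disjoint T W ∧ (∃ A ∈ H, A ⊆ W ∪ T) ∧
      ∀ A ∈ H, A ⊆ W ∪ T → T ⊆ A) :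
    binomExp p X (fun W => ∑ T ∈ U W, q ^ T.card) ≤ (4 * (q / p)) ^ m := by
  set G : Finset α → Finset (Finset α) := fun Z =>
    X.powerset.filter (fun T => m ≤ T.card ∧ (∃ A ∈ H, A ⊆ Z) ∧ ∀ A ∈ H, A ⊆ Z → T ⊆ A)
    with hG
  have h1p := sub_nonneg.2 hp₁
  have hqp' : q / p ≤ 1 := div_le_one_of_le₀ hqp hp.le
  have hqp0 : 0 ≤ q / p := by positivity
  calc binomExp p X (fun W => ∑ T ∈ U W, q ^ T.card)
      = ∑ x ∈ X.powerset.sigma U,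
          p ^ x.1.card * (1 - p) ^ (X \ x.1).card * q ^ x.2.card := by
        simp only [binomExp, Finset.mul_sum, Finset.sum_sigma']
    _ ≤ ∑ x ∈ X.powerset.sigma U, p ^ (x.1 ∪ x.2).card * (1 - p) ^ (X \ (x.1 ∪ x.2)).card
          * (q / p) ^ x.2.card := by
        refine Finset.sum_le_sum fun x hx => ?_
        obtain ⟨W, T⟩ := x
        simp only [Finset.mem_sigma, Finset.mem_powerset] at hx
        obtain ⟨-, -, hd, -⟩ := hU W hx.1 T hx.2
        simp only
        rw [Finset.card_union_of_disjoint hd.symm, pow_add, div_pow]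
        have : p ^ W.card * p ^ T.card * (1 - p) ^ (X \ (W ∪ T)).card
            * (q ^ T.card / p ^ T.card)
            = p ^ W.card * (1 - p) ^ (X \ (W ∪ T)).card * q ^ T.card := by
          field_simp
        rw [this]
        have hle : (1 - p) ^ (X \ W).card ≤ (1 - p) ^ (X \ (W ∪ T)).card :=
          pow_le_pow_of_le_one h1p (by linarith)
            (Finset.card_le_card (Finset.sdiff_subset_sdiff le_rfl Finset.subset_union_left))
        gcongr
    _ = ∑ y ∈ (X.powerset.sigma U).image
            (fun x => (⟨x.1 ∪ x.2, x.2⟩ : (_ : Finset α) × Finset α)),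
          p ^ y.1.card * (1 - p) ^ (X \ y.1).card * (q / p) ^ y.2.card := by
        rw [Finset.sum_image]
        rintro ⟨W, T⟩ hx ⟨W', T'⟩ hx' h
        simp only [Finset.coe_sigma, Set.mem_sigma_iff, Finset.mem_coe,
          Finset.mem_powerset] at hx hx'
        simp only [Sigma.mk.injEq, heq_eq_eq] at h
        obtain ⟨h1, rfl⟩ := h
        obtain ⟨-, -, hd, -⟩ := hU W hx.1 T hx.2
        obtain ⟨-, -, hd', -⟩ := hU W' hx'.1 T hx'.2
        have : W = W' := by
          rw [← Finset.union_sdiff_cancel_right hd.symm, h1,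
            Finset.union_sdiff_cancel_right hd'.symm]
        rw [this]
    _ ≤ ∑ y ∈ X.powerset.sigma G,
          p ^ y.1.card * (1 - p) ^ (X \ y.1).card * (q / p) ^ y.2.card := by
        refine Finset.sum_le_sum_of_subset_of_nonneg ?_ fun _ _ _ => by positivity
        intro y hy
        obtain ⟨⟨W, T⟩, hx, rfl⟩ := Finset.mem_image.1 hy
        simp only [Finset.mem_sigma, Finset.mem_powerset] at hx
        obtain ⟨hTX, hm, -, hA, hB⟩ := hU W hx.1 T hx.2
        simp only [hG, Finset.mem_sigma, Finset.mem_powerset, Finset.mem_filter]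
        exact ⟨Finset.union_subset hx.1 hTX, hTX, hm, hA, hB⟩
    _ = binomExp p X (fun Z => ∑ T ∈ G Z, (q / p) ^ T.card) := by
        simp only [binomExp, Finset.mul_sum, Finset.sum_sigma']
    _ ≤ binomExp p X (fun _ => (4 * (q / p)) ^ m) := by
        refine binomExp_mono hp.le hp₁ fun Z _ => ?_
        have hcard : (G Z).card ≤ 4 ^ m := by
          by_cases hZ : ∃ A ∈ H, A ⊆ Z
          · obtain ⟨A, hA, hAZ⟩ := hZ
            calc (G Z).card ≤ A.powerset.card := by
                  refine Finset.card_le_card fun T hT => ?_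
                  rw [Finset.mem_powerset]
                  exact (Finset.mem_filter.1 hT).2.2.2 A hA hAZ
              _ = 2 ^ A.card := Finset.card_powerset A
              _ ≤ 2 ^ (2 * m) := Nat.pow_le_pow_right (by norm_num) (hH A hA)
              _ = 4 ^ m := by rw [pow_mul]; norm_num
          · have : G Z = ∅ := by
              refine Finset.filter_eq_empty_iff.2 fun T _ h => hZ h.2.1
            simp [this]
        calc ∑ T ∈ G Z, (q / p) ^ T.card ≤ ∑ T ∈ G Z, (q / p) ^ m :=
              Finset.sum_le_sum fun T hT =>
                pow_le_pow_of_le_one hqp0 hqp' (Finset.mem_filter.1 hT).2.1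
          _ = (G Z).card * (q / p) ^ m := by simp
          _ ≤ (4 ^ m : ℕ) * (q / p) ^ m := by gcongr
          _ = (4 * (q / p)) ^ m := by push_cast; rw [mul_pow]
    _ = _ := binomExp_const p X _

open Classical in
/-- The probability that a binomial random subset of `X` contains no member of `H`. -/
noncomputable def missProb (p : ℝ) (X : Finset α) (H : Finset (Finset α)) : ℝ :=
  binomExp p X (fun W => if ∃ S ∈ H, S ⊆ W then 0 else 1)

lemma missProb_nonneg {p : ℝ} (hp₀ : 0 ≤ p) (hp₁ : p ≤ 1) (X : Finset α)
    (H : Finset (Finset α)) : 0 ≤ missProb p X H := by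
  rw [← binomExp_const p X 0]
  exact binomExp_mono hp₀ hp₁ fun W _ => by split_ifs <;> norm_num

lemma missProb_le_one {p : ℝ} (hp₀ : 0 ≤ p) (hp₁ : p ≤ 1) (X : Finset α)
    (H : Finset (Finset α)) : missProb p X H ≤ 1 := by
  rw [← binomExp_const p X 1]
  exact binomExp_mono hp₀ hp₁ fun W _ => by split_ifs <;> norm_num

open Classical in
/-- If every cover of a family `H` of sets with fewer than `2 ^ j` elements costs at least `c`,
then a union of `j` independent binomial random sets is likely to contain a member of `H`. -/
theorem missProb_mul_le {p q : ℝ} (hq : 0 ≤ q) (hp : 0 < p) (hp₁ : p ≤ 1) (hqp : q ≤ p)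
    (X : Finset α) (hsmall : 4 * (q / p) ≤ 1) (j : ℕ) (H : Finset (Finset α))
    (hHX : ∀ S ∈ H, S ⊆ X) (hH : ∀ S ∈ H, S.card < 2 ^ j) (c : ℝ)
    (hc : ∀ U : Finset (Finset α), (∀ S ∈ H, ∃ T ∈ U, T ⊆ S) → c ≤ ∑ T ∈ U, q ^ T.card) :
    missProb (1 - (1 - p) ^ j) X H * c ≤ ∑ i ∈ Finset.range j, (4 * (q / p)) ^ (i + 1) := by
  have h1p := sub_nonneg.2 hp₁
  have hqp0 : 0 ≤ 4 * (q / p) := by positivity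
  induction j generalizing H c with
  | zero =>
    by_cases hne : H.Nonempty
    · obtain ⟨S, hS⟩ := hne
      have hS0 : S = ∅ := Finset.card_eq_zero.1 (by simpa using hH S hS)
      have hall : ∀ W : Finset α, ∃ S ∈ H, S ⊆ W := fun W => ⟨S, hS, by simp [hS0]⟩
      simp [missProb, hall, binomExp_const]
    · have hle : c ≤ 0 := by
        simpa using hc ∅ (fun S hS => absurd ⟨S, hS⟩ hne)
      have := missProb_nonneg (p := 1 - (1 - p) ^ 0) (by simp) (by simp) X H
      simpa using mul_nonpos_of_nonneg_of_nonpos this hle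
  | succ j ih =>
    set ε := ∑ i ∈ Finset.range j, (4 * (q / p)) ^ (i + 1) with hε
    set r := 1 - (1 - p) ^ j with hr
    have hr₀ : 0 ≤ r := sub_nonneg.2 (pow_le_one₀ h1p (by linarith))
    have hr₁ : r ≤ 1 := by have := pow_nonneg h1p j; linarith
    have hR : 1 - (1 - p) ^ (j + 1) = p + r - p * r := by rw [hr, pow_succ]; ring
    rcases le_total c 0 with hc0 | hc0
    · refine (mul_nonpos_of_nonneg_of_nonpos (missProb_nonneg ?_ ?_ X H) hc0).trans ?_
      · exact sub_nonneg.2 (pow_le_one₀ h1p (by linarith))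
      · have := pow_nonneg h1p (j + 1); linarith
      · exact Finset.sum_nonneg fun i _ => by positivity
    choose! frag hfS hfd hfA hfm using fun (W S : Finset α) (hS : S ∈ H) =>
      exists_fragment H W hS
    set F : Finset α → Finset (Finset α) := fun W => H.image (frag W) with hF
    set U : Finset α → Finset (Finset α) := fun W => (F W).filter (2 ^ j ≤ ·.card) with hU
    set H' : Finset α → Finset (Finset α) := fun W => (F W).filter (·.card < 2 ^ j) with hH'
    have hcost : binomExp p X (fun W => ∑ T ∈ U W, q ^ T.card) ≤ (4 * (q / p)) ^ (j + 1) := by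
      refine (binomExp_cost_le hq hp hp₁ hqp X H (2 ^ j) ?_ U ?_).trans ?_
      · intro S hS
        have := hH S hS
        rw [pow_succ] at this
        lia
      · intro W _ T hT
        obtain ⟨hT, hm⟩ := Finset.mem_filter.1 hT
        obtain ⟨S, hS, rfl⟩ := Finset.mem_image.1 hT
        exact ⟨(hfS W S hS).trans (hHX S hS), hm, hfd W S hS, hfA W S hS, hfm W S hS⟩
      · exact pow_le_pow_of_le_one hqp0 hsmall (Nat.succ_le_of_lt Nat.lt_two_pow_self)
    have hstep : ∀ W ⊆ X, missProb r X (H' W) * c ≤ ε + ∑ T ∈ U W, q ^ T.card := by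
      intro W _
      have hIH := ih (H' W) ?_ ?_ (c - ∑ T ∈ U W, q ^ T.card) ?_
      · have h1 := missProb_le_one hr₀ hr₁ X (H' W)
        have h2 : 0 ≤ ∑ T ∈ U W, q ^ T.card := Finset.sum_nonneg fun _ _ => by positivity
        nlinarith
      · intro T hT
        obtain ⟨S, hS, rfl⟩ := Finset.mem_image.1 (Finset.mem_filter.1 hT).1
        exact (hfS W S hS).trans (hHX S hS)
      · exact fun T hT => (Finset.mem_filter.1 hT).2
      · intro V hV
        have hcov := hc (U W ∪ V) ?_
        · have hle : ∑ T ∈ U W ∪ V, q ^ T.card ≤ ∑ T ∈ U W, q ^ T.card + ∑ T ∈ V, q ^ T.card := by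
            rw [← Finset.sum_union_inter]
            exact le_add_of_nonneg_right (Finset.sum_nonneg fun _ _ => by positivity)
          linarith
        · intro S hS
          have hmem : frag W S ∈ F W := Finset.mem_image_of_mem _ hS
          rcases lt_or_ge (frag W S).card (2 ^ j) with hlt | hge
          · obtain ⟨T, hT, hTS⟩ := hV _ (Finset.mem_filter.2 ⟨hmem, hlt⟩)
            exact ⟨T, Finset.mem_union_right _ hT, hTS.trans (hfS W S hS)⟩
          · exact ⟨_, Finset.mem_union_left _ (Finset.mem_filter.2 ⟨hmem, hge⟩), hfS W S hS⟩
    calc missProb (1 - (1 - p) ^ (j + 1)) X H * c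
        = binomExp p X (fun A => binomExp r X
            (fun B => if ∃ S ∈ H, S ⊆ A ∪ B then 0 else 1)) * c := by
          rw [hR, missProb, ← binomExp_union]
      _ ≤ binomExp p X (fun A => missProb r X (H' A)) * c := by
          refine mul_le_mul_of_nonneg_right ?_ hc0
          refine binomExp_mono hp.le hp₁ fun A _ => binomExp_mono hr₀ hr₁ fun B _ => ?_
          by_cases hB : ∃ T ∈ H' A, T ⊆ B
          · obtain ⟨T, hT, hTB⟩ := hB
            obtain ⟨S, hS, rfl⟩ := Finset.mem_image.1 (Finset.mem_filter.1 hT).1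
            obtain ⟨C, hC, hCA⟩ := hfA A S hS
            rw [if_pos ⟨C, hC, hCA.trans (Finset.union_subset_union_right hTB)⟩]
            split_ifs <;> norm_num
          · rw [if_neg hB]
            split_ifs <;> norm_num
      _ = binomExp p X (fun A => missProb r X (H' A) * c) := by
          rw [mul_comm, ← binomExp_const_mul]
          simp only [mul_comm]
      _ ≤ binomExp p X (fun A => ε + ∑ T ∈ U A, q ^ T.card) := binomExp_mono hp.le hp₁ hstep
      _ ≤ ε + (4 * (q / p)) ^ (j + 1) := by
          rw [binomExp_add, binomExp_const]
          linarith
      _ = _ := by rw [Finset.sum_range_succ]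

end RandomSubset

section CountEmbeddings

lemma pow_mul_factorial_sub_le (n v : ℕ) (hv : v ≤ n) :
    (n : ℝ) ^ v * ((n - v).factorial : ℝ) ≤ Real.exp 1 ^ v * (n.factorial : ℝ) := by
  induction v generalizing n with
  | zero => simp
  | succ v ih =>
    obtain ⟨n, rfl⟩ : ∃ k, n = k + 1 := ⟨n - 1, by lia⟩
    have hvn : v ≤ n := by lia
    have hratio : ((n : ℝ) + 1) ^ v ≤ Real.exp 1 * (n : ℝ) ^ v := by
      rcases Nat.eq_zero_or_pos n with rfl | hn
      · obtain rfl : v = 0 := by lia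
        simp
      have hn' : (0 : ℝ) < n := by exact_mod_cast hn
      calc ((n : ℝ) + 1) ^ v = (1 / n + 1) ^ v * (n : ℝ) ^ v := by
            rw [← mul_pow]; congr 1; field_simp; ring
        _ ≤ Real.exp (1 / n) ^ v * (n : ℝ) ^ v := by
            gcongr; exact Real.add_one_le_exp _
        _ = Real.exp (v / n) * (n : ℝ) ^ v := by
            rw [← Real.exp_nat_mul]; congr 2; ring
        _ ≤ _ := by
            gcongr
            exact div_le_one_of_le₀ (by exact_mod_cast hvn) hn'.le
    have hsub : n + 1 - (v + 1) = n - v := by lia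
    rw [hsub, Nat.factorial_succ]
    push_cast
    have := ih n hvn
    calc ((n : ℝ) + 1) ^ (v + 1) * ((n - v).factorial : ℝ)
        = (n + 1) * (((n : ℝ) + 1) ^ v * ((n - v).factorial : ℝ)) := by ring
      _ ≤ (n + 1) * (Real.exp 1 * (n : ℝ) ^ v * ((n - v).factorial : ℝ)) := by gcongr
      _ = (n + 1) * Real.exp 1 * ((n : ℝ) ^ v * ((n - v).factorial : ℝ)) := by ring
      _ ≤ (n + 1) * Real.exp 1 * (Real.exp 1 ^ v * (n.factorial : ℝ)) := by gcongr
      _ = _ := by ring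

open Classical in
lemma card_equiv_eqOn {W V : Type*} [Fintype W] [Fintype V] (ψ₀ : W ≃ V) (Y : Finset W) :
    (Finset.univ.filter (fun ψ : W ≃ V => ∀ x ∈ Y, ψ x = ψ₀ x)).card
      = (Fintype.card W - Y.card).factorial := by
  have e : {ψ : W ≃ V // ∀ x ∈ Y, ψ x = ψ₀ x} ≃ Equiv.Perm {x // x ∉ Y} := by
    refine Equiv.trans ?_ (Equiv.Perm.subtypeEquivSubtypePerm (fun x => x ∉ Y)).symm
    refine Equiv.subtypeEquiv (Equiv.equivCongr (Equiv.refl W) ψ₀.symm) fun ψ => ?_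
    simp [Equiv.equivCongr, Equiv.symm_apply_eq]
  rw [← Fintype.card_subtype, Fintype.card_congr e, Fintype.card_perm]
  simp [Fintype.card_subtype_compl]

open Classical in
/-- The number of bijections `ψ` onto the vertices of a rooted forest in which every vertex has at
most two children, told apart by `lab`, such that `ψ (a e)` is a child of `ψ (b e)` for all
`e ∈ T`. -/
lemma card_oriented_le {W V ι : Type*} [Fintype W] [Fintype V] (child : V → V → Prop)
    (depth : V → ℕ) (lab : V → Bool)
    (hdepth : ∀ x y, child x y → depth y < depth x)
    (huniq : ∀ x y y', child x y → child x y' → y = y')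
    (hlab : ∀ x x' y, child x y → child x' y → lab x = lab x' → x = x')
    (T : Finset ι) (a b : ι → W)
    (hab : ∀ e ∈ T, ∀ e' ∈ T, a e = a e' → b e = b e' → e = e') :
    (Fintype.card W : ℝ) ^ T.card
        * (Finset.univ.filter (fun ψ : W ≃ V => ∀ e ∈ T, child (ψ (a e)) (ψ (b e)))).card
      ≤ (2 * Real.exp 1 ^ 2) ^ T.card * ((Fintype.card W).factorial : ℝ) := by
  set F := Finset.univ.filter (fun ψ : W ≃ V => ∀ e ∈ T, child (ψ (a e)) (ψ (b e))) with hF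
  rcases F.eq_empty_or_nonempty with hempty | ⟨ψ₁, hψ₁⟩
  · rw [hempty]; simp; positivity
  have hVW : Fintype.card V = Fintype.card W := (Fintype.card_congr ψ₁).symm
  replace hψ₁ := (Finset.mem_filter.1 hψ₁).2
  have hinj : Set.InjOn a T := fun e he e' he' h =>
    hab e he e' he' h (ψ₁.injective (huniq _ _ _ (hψ₁ e he) (by rw [h]; exact hψ₁ e' he')))
  set A := T.image a with hA
  set R := T.image b \ A with hR
  have hAcard : A.card = T.card := Finset.card_image_of_injOn hinj
  have hRcard : R.card ≤ T.card :=
    (Finset.card_le_card Finset.sdiff_subset).trans Finset.card_image_le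
  have hYcard : (A ∪ R).card = T.card + R.card := by
    rw [Finset.card_union_of_disjoint Finset.disjoint_sdiff, hAcard]
  have hYle : T.card + R.card ≤ Fintype.card W := hYcard ▸ Finset.card_le_univ _
  let g : (W ≃ V) → (R → V) × (A → Bool) := fun ψ => (fun x => ψ x, fun x => lab (ψ x))
  have hagree : ∀ ψ ∈ F, ∀ ψ' ∈ F, g ψ = g ψ' → ∀ x ∈ A ∪ R, ψ x = ψ' x := by
    intro ψ hψ ψ' hψ' hg
    replace hψ := (Finset.mem_filter.1 hψ).2
    replace hψ' := (Finset.mem_filter.1 hψ').2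
    obtain ⟨hg1, hg2⟩ := Prod.mk.inj hg
    have hRx : ∀ x ∈ R, ψ x = ψ' x := fun x hx => congrFun hg1 ⟨x, hx⟩
    have hAx : ∀ d, ∀ x ∈ A, depth (ψ x) = d → ψ x = ψ' x := by
      intro d
      induction d using Nat.strong_induction_on with
      | _ d ih =>
        intro x hx hd
        have hl : lab (ψ x) = lab (ψ' x) := congrFun hg2 ⟨x, hx⟩
        obtain ⟨e, he, rfl⟩ := Finset.mem_image.1 hx
        have hb : ψ (b e) = ψ' (b e) := by
          by_cases hbA : b e ∈ A
          · exact ih _ (hd ▸ hdepth _ _ (hψ e he)) _ hbA rfl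
          · exact hRx _ (Finset.mem_sdiff.2 ⟨Finset.mem_image_of_mem _ he, hbA⟩)
        exact hlab _ _ _ (hψ e he) (hb ▸ hψ' e he) hl
    intro x hx
    rcases Finset.mem_union.1 hx with hx | hx
    · exact hAx _ x hx rfl
    · exact hRx x hx
  have hcount : F.card ≤ (Fintype.card W - (T.card + R.card)).factorial
      * (Fintype.card W ^ R.card * 2 ^ T.card) := by
    have := Finset.card_le_mul_card_image_of_maps_to (s := F) (f := g) (t := Finset.univ)
      (fun _ _ => Finset.mem_univ _) ((Fintype.card W - (T.card + R.card)).factorial) ?_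
    · simpa [Fintype.card_prod, hVW, hAcard] using this
    · intro y _
      rcases (F.filter (fun ψ => g ψ = y)).eq_empty_or_nonempty with h0 | ⟨ψ₀, hψ₀⟩
      · rw [h0]; simp
      · rw [← hYcard, ← card_equiv_eqOn ψ₀ (A ∪ R)]
        refine Finset.card_le_card fun ψ hψ => ?_
        obtain ⟨hψ₀F, hψ₀y⟩ := Finset.mem_filter.1 hψ₀
        obtain ⟨hψF, hψy⟩ := Finset.mem_filter.1 hψ
        exact Finset.mem_filter.2 ⟨Finset.mem_univ _, hagree ψ hψF ψ₀ hψ₀F (hψy.trans hψ₀y.symm)⟩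
  have hcount' : (F.card : ℝ) ≤ ((Fintype.card W - (T.card + R.card)).factorial : ℝ)
      * ((Fintype.card W : ℝ) ^ R.card * 2 ^ T.card) := by exact_mod_cast hcount
  set n := Fintype.card W
  have he1 : 1 ≤ Real.exp 1 := Real.one_le_exp zero_le_one
  calc (n : ℝ) ^ T.card * F.card
      ≤ (n : ℝ) ^ T.card * (((n - (T.card + R.card)).factorial : ℝ)
        * ((n : ℝ) ^ R.card * 2 ^ T.card)) := by gcongr
    _ = 2 ^ T.card * ((n : ℝ) ^ (T.card + R.card) * ((n - (T.card + R.card)).factorial : ℝ)) := by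
        rw [pow_add]; ring
    _ ≤ 2 ^ T.card * (Real.exp 1 ^ (T.card + R.card) * (n.factorial : ℝ)) := by
        gcongr 2 ^ T.card * ?_
        exact pow_mul_factorial_sub_le n _ hYle
    _ ≤ 2 ^ T.card * (Real.exp 1 ^ (2 * T.card) * (n.factorial : ℝ)) := by
        gcongr
        lia
    _ = _ := by rw [mul_pow, ← pow_mul]; ring

open Classical in
lemma card_filter_mk_eq_le {W : Type*} [Fintype W] (e : Sym2 W) :
    (Finset.univ.filter (fun x : W × W => s(x.1, x.2) = e)).card ≤ 2 := by
  induction e with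
  | _ x y =>
    refine (Finset.card_le_card (t := {(x, y), (y, x)}) fun z hz => ?_).trans Finset.card_le_two
    have := (Finset.mem_filter.1 hz).2
    simpa [Sym2.eq_iff, Prod.ext_iff] using this

open Classical in
/-- The number of bijections onto the vertices of a rooted forest of maximum down-degree at most
two that map every edge of `T` to an edge of the forest. -/
lemma card_embeddings_le {W V : Type*} [Fintype W] [Fintype V] (child : V → V → Prop)
    (depth : V → ℕ) (lab : V → Bool)
    (hdepth : ∀ x y, child x y → depth y < depth x)
    (huniq : ∀ x y y', child x y → child x y' → y = y')
    (hlab : ∀ x x' y, child x y → child x' y → lab x = lab x' → x = x')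
    (T : Finset (Sym2 W)) :
    (Fintype.card W : ℝ) ^ T.card * (Finset.univ.filter (fun ψ : W ≃ V =>
        ∀ e ∈ T, e ∈ ((SimpleGraph.fromRel child).comap ψ).edgeSet)).card
      ≤ (4 * Real.exp 1 ^ 2) ^ T.card * ((Fintype.card W).factorial : ℝ) := by
  set P : Finset ((e : Sym2 W) → e ∈ T → W × W) :=
    T.pi (fun e => Finset.univ.filter (fun x : W × W => s(x.1, x.2) = e)) with hP
  set c : ((e : Sym2 W) → e ∈ T → W × W) → Finset (W ≃ V) := fun o =>
    Finset.univ.filter (fun ψ : W ≃ V =>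
      ∀ e ∈ T.attach, child (ψ (o e.1 e.2).1) (ψ (o e.1 e.2).2)) with hc
  have hPcard : P.card ≤ 2 ^ T.card := by
    rw [hP, Finset.card_pi]
    exact Finset.prod_le_pow_card _ _ _ fun e _ => card_filter_mk_eq_le e
  have hcov : Finset.univ.filter (fun ψ : W ≃ V =>
      ∀ e ∈ T, e ∈ ((SimpleGraph.fromRel child).comap ψ).edgeSet) ⊆ P.biUnion c := by
    intro ψ hψ
    replace hψ := (Finset.mem_filter.1 hψ).2
    have : ∀ e ∈ T, ∃ x : W × W, s(x.1, x.2) = e ∧ child (ψ x.1) (ψ x.2) := by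
      intro e he
      have h := hψ e he
      induction e with
      | _ x y =>
        simp only [SimpleGraph.mem_edgeSet, SimpleGraph.comap_adj,
          SimpleGraph.fromRel_adj] at h
        rcases h.2 with h | h
        · exact ⟨(x, y), rfl, h⟩
        · exact ⟨(y, x), Sym2.eq_swap, h⟩
    choose o ho1 ho2 using this
    refine Finset.mem_biUnion.2 ⟨o, ?_, ?_⟩
    · rw [hP, Finset.mem_pi]
      exact fun e he => Finset.mem_filter.2 ⟨Finset.mem_univ _, ho1 e he⟩
    · exact Finset.mem_filter.2 ⟨Finset.mem_univ _, fun e _ => ho2 e.1 e.2⟩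
  have hoc : ∀ o ∈ P, (Fintype.card W : ℝ) ^ T.card * (c o).card
      ≤ (2 * Real.exp 1 ^ 2) ^ T.card * ((Fintype.card W).factorial : ℝ) := by
    intro o ho
    rw [hP, Finset.mem_pi] at ho
    have ho' : ∀ e : {e // e ∈ T}, s((o e.1 e.2).1, (o e.1 e.2).2) = e.1 := fun e =>
      (Finset.mem_filter.1 (ho e.1 e.2)).2
    have := card_oriented_le child depth lab hdepth huniq hlab T.attach
      (fun e => (o e.1 e.2).1) (fun e => (o e.1 e.2).2)
      (fun e _ e' _ h1 h2 => Subtype.ext (by rw [← ho' e, ← ho' e', h1, h2]))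
    rw [Finset.card_attach] at this
    convert this
  set n := Fintype.card W
  calc (n : ℝ) ^ T.card * _ ≤ (n : ℝ) ^ T.card * ∑ o ∈ P, ((c o).card : ℝ) := by
        gcongr
        exact_mod_cast (Finset.card_le_card hcov).trans Finset.card_biUnion_le
    _ = ∑ o ∈ P, (n : ℝ) ^ T.card * (c o).card := Finset.mul_sum _ _ _
    _ ≤ ∑ o ∈ P, (2 * Real.exp 1 ^ 2) ^ T.card * (n.factorial : ℝ) := Finset.sum_le_sum hoc
    _ = P.card * ((2 * Real.exp 1 ^ 2) ^ T.card * (n.factorial : ℝ)) := by simp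
    _ ≤ (2 ^ T.card : ℕ) * ((2 * Real.exp 1 ^ 2) ^ T.card * (n.factorial : ℝ)) := by gcongr
    _ = _ := by
        push_cast
        rw [← mul_assoc, ← mul_pow]; congr 2; ring

end CountEmbeddings

section Comb

open Classical in
lemma probOf_eq_binomExp (n : ℕ) (p : ℝ) (P : SimpleGraph (Fin n) → Prop) :
    probOf n p P = binomExp p (⊤ : SimpleGraph (Fin n)).edgeFinset
      (fun W => if P (SimpleGraph.fromEdgeSet (W : Set (Sym2 (Fin n)))) then 1 else 0) := by
  have hcard : (⊤ : SimpleGraph (Fin n)).edgeFinset.card = n.choose 2 := by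
    simpa using SimpleGraph.card_edgeFinset_top_eq_card_choose_two (V := Fin n)
  have hsub : ∀ G : SimpleGraph (Fin n), G.edgeFinset ⊆ (⊤ : SimpleGraph (Fin n)).edgeFinset :=
    fun G => SimpleGraph.edgeFinset_mono le_top
  unfold probOf binomExp
  refine Finset.sum_bij' (fun G _ => G.edgeFinset)
    (fun W _ => SimpleGraph.fromEdgeSet (W : Set (Sym2 (Fin n)))) ?_ ?_ ?_ ?_ ?_
  · exact fun G _ => Finset.mem_powerset.2 (hsub G)
  · exact fun _ _ => Finset.mem_univ _
  · intro G _
    simp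
  · intro W hW
    have hW := Finset.mem_powerset.1 hW
    ext e
    simp only [SimpleGraph.mem_edgeFinset, SimpleGraph.edgeSet_fromEdgeSet, Set.mem_sdiff,
      Finset.mem_coe, and_iff_left_iff_imp]
    intro he
    have := hW he
    rw [SimpleGraph.mem_edgeFinset, SimpleGraph.edgeSet_top] at this
    exact this
  · intro G _
    rw [Finset.card_sdiff_of_subset (hsub G), hcard, ← Set.ncard_coe_finset]
    simp

/-- `x` is a child of `y` in the comb rooted at the first vertex of its spine. -/
def combChild (m k : ℕ) (x y : Fin m × Fin k) : Prop :=
  ((y.2 : ℕ) = 0 ∧ (x.2 : ℕ) = 0 ∧ (x.1 : ℕ) = (y.1 : ℕ) + 1) ∨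
    (y.1 = x.1 ∧ (x.2 : ℕ) = (y.2 : ℕ) + 1)

lemma fromRel_combChild (m k : ℕ) : SimpleGraph.fromRel (combChild m k) = comb m k := by
  ext x y
  simp only [comb, SimpleGraph.fromRel_adj, combChild]
  exact and_congr_right fun _ => or_comm

open Classical in
lemma card_comb_embeddings_le {W : Type*} [Fintype W] (m k : ℕ) (T : Finset (Sym2 W)) :
    (Fintype.card W : ℝ) ^ T.card * (Finset.univ.filter (fun ψ : W ≃ Fin m × Fin k =>
        ∀ e ∈ T, e ∈ ((comb m k).comap ψ).edgeSet)).card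
      ≤ (4 * Real.exp 1 ^ 2) ^ T.card * ((Fintype.card W).factorial : ℝ) := by
  have h := card_embeddings_le (W := W) (combChild m k) (fun x => (x.1 : ℕ) + x.2)
    (fun x => decide ((x.2 : ℕ) = 0)) ?_ ?_ ?_ T
  · simp only [fromRel_combChild] at h
    convert h
  · rintro ⟨x₁, x₂⟩ ⟨y₁, y₂⟩ h
    simp only [combChild, Fin.ext_iff] at h ⊢
    lia
  · rintro ⟨x₁, x₂⟩ ⟨y₁, y₂⟩ ⟨z₁, z₂⟩ h h'
    simp only [combChild, Prod.mk.injEq, Fin.ext_iff] at h h' ⊢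
    lia
  · rintro ⟨x₁, x₂⟩ ⟨y₁, y₂⟩ ⟨z₁, z₂⟩ h h' hl
    simp only [combChild, Prod.mk.injEq, Fin.ext_iff, decide_eq_decide] at h h' hl ⊢
    lia

/-- Every family of edge sets that covers all spanning combs has cost at least one. -/
lemma one_le_sum_of_cover_comb {W : Type*} [Fintype W] (m k : ℕ)
    (hW : Fintype.card W = m * k) (U : Finset (Finset (Sym2 W)))
    (hU : ∀ ψ : W ≃ Fin m × Fin k, ∃ T ∈ U, ∀ e ∈ T, e ∈ ((comb m k).comap ψ).edgeSet) :
    1 ≤ ∑ T ∈ U, (4 * Real.exp 1 ^ 2 / (Fintype.card W : ℝ)) ^ T.card := by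
  classical
  set C : Finset (Sym2 W) → Finset (W ≃ Fin m × Fin k) := fun T =>
    Finset.univ.filter (fun ψ => ∀ e ∈ T, e ∈ ((comb m k).comap ψ).edgeSet) with hC
  have hsub : (Finset.univ : Finset (W ≃ Fin m × Fin k)) ⊆ U.biUnion C := by
    intro ψ _
    obtain ⟨T, hT, hTψ⟩ := hU ψ
    exact Finset.mem_biUnion.2 ⟨T, hT, Finset.mem_filter.2 ⟨Finset.mem_univ _, hTψ⟩⟩
  have hle := (Finset.card_le_card hsub).trans Finset.card_biUnion_le
  rw [Finset.card_univ, Fintype.card_equiv (Fintype.equivOfCardEq (by simp [hW]))] at hle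
  have hCcard : ∀ T, (Fintype.card W : ℝ) ^ T.card * (C T).card
      ≤ (4 * Real.exp 1 ^ 2) ^ T.card * ((Fintype.card W).factorial : ℝ) := by
    intro T
    convert card_comb_embeddings_le m k T
  set n := Fintype.card W
  have hfac : (0 : ℝ) < (n.factorial : ℝ) := by exact_mod_cast Nat.factorial_pos _
  have hle' : (n.factorial : ℝ)
      ≤ ∑ T ∈ U, (4 * Real.exp 1 ^ 2 / (n : ℝ)) ^ T.card * (n.factorial : ℝ) := by
    calc (n.factorial : ℝ) ≤ ∑ T ∈ U, ((C T).card : ℝ) := by exact_mod_cast hle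
      _ ≤ _ := by
        refine Finset.sum_le_sum fun T _ => ?_
        rcases T.eq_empty_or_nonempty with rfl | hT
        · simpa using hCcard ∅
        · have hn : (0 : ℝ) < n := by
            obtain ⟨e, -⟩ := hT
            induction e with
            | _ x y => exact_mod_cast Fintype.card_pos_iff.2 ⟨x⟩
          rw [div_pow, div_mul_eq_mul_div, le_div_iff₀ (by positivity), mul_comm]
          exact hCcard T
  rw [← Finset.sum_mul] at hle'
  exact le_of_mul_le_mul_right (by linarith) hfac

open Classical in
/-- A lower bound for the probability that a union of `J` independent random graphs contains a
spanning comb. -/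
lemma one_sub_le_probOf_comb (s J : ℕ) (hs : 0 < s) {p : ℝ} (hp : 0 < p) (hp₁ : p ≤ 1)
    (hsmall : 4 * (4 * Real.exp 1 ^ 2 / (s : ℝ) ^ 2 / p) ≤ 1) (hJ : (s ^ 2).choose 2 < 2 ^ J) :
    1 - ∑ i ∈ Finset.range J, (4 * (4 * Real.exp 1 ^ 2 / (s : ℝ) ^ 2 / p)) ^ (i + 1)
      ≤ probOf (s ^ 2) (1 - (1 - p) ^ J) (fun G => ContainsCopy (comb s s) G) := by
  set q := 4 * Real.exp 1 ^ 2 / (s : ℝ) ^ 2 with hq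
  have hq0 : 0 ≤ q := by positivity
  have hqp : q ≤ p := by
    have : 0 ≤ q / p := by positivity
    exact (div_le_one hp).1 (by linarith)
  set X := (⊤ : SimpleGraph (Fin (s ^ 2))).edgeFinset with hX
  have hXcard : X.card = (s ^ 2).choose 2 := by
    have h := SimpleGraph.card_edgeFinset_top_eq_card_choose_two (V := Fin (s ^ 2))
    rw [Fintype.card_fin] at h
    rw [hX, ← h]
  set H : Finset (Finset (Sym2 (Fin (s ^ 2)))) := Finset.univ.image
    (fun ψ : Fin (s ^ 2) ≃ Fin s × Fin s => ((comb s s).comap ψ).edgeFinset) with hH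
  have hHX : ∀ S ∈ H, S ⊆ X := by
    intro S hS
    obtain ⟨ψ, -, rfl⟩ := Finset.mem_image.1 hS
    exact SimpleGraph.edgeFinset_mono le_top
  have hcover : ∀ U : Finset (Finset (Sym2 (Fin (s ^ 2)))), (∀ S ∈ H, ∃ T ∈ U, T ⊆ S) →
      1 ≤ ∑ T ∈ U, q ^ T.card := by
    intro U hU
    have h := one_le_sum_of_cover_comb (W := Fin (s ^ 2)) s s (by simp [sq]) U fun ψ => by
      obtain ⟨T, hT, hTS⟩ := hU _ (Finset.mem_image_of_mem _ (Finset.mem_univ ψ))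
      exact ⟨T, hT, fun e he => SimpleGraph.mem_edgeFinset.1 (hTS he)⟩
    simpa only [Fintype.card_fin, Nat.cast_pow] using h
  have hmiss := missProb_mul_le hq0 hp hp₁ hqp X hsmall J H hHX
    (fun S hS => (Finset.card_le_card (hHX S hS)).trans_lt (hXcard ▸ hJ)) 1 hcover
  have h1p := sub_nonneg.2 hp₁
  have hr₀ : 0 ≤ 1 - (1 - p) ^ J := sub_nonneg.2 (pow_le_one₀ h1p (by linarith))
  have hr₁ : 1 - (1 - p) ^ J ≤ 1 := by have := pow_nonneg h1p J; linarith
  have hsum : 1 ≤ missProb (1 - (1 - p) ^ J) X H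
      + probOf (s ^ 2) (1 - (1 - p) ^ J) (fun G => ContainsCopy (comb s s) G) := by
    rw [probOf_eq_binomExp, missProb, ← hX, ← binomExp_add]
    refine (binomExp_const (1 - (1 - p) ^ J) X 1).symm.le.trans ?_
    refine binomExp_mono hr₀ hr₁ fun W _ => ?_
    by_cases hW : ∃ S ∈ H, S ⊆ W
    · have hcopy : ContainsCopy (comb s s)
          (SimpleGraph.fromEdgeSet (W : Set (Sym2 (Fin (s ^ 2))))) := by
        obtain ⟨S, hS, hSW⟩ := hW
        obtain ⟨ψ, -, rfl⟩ := Finset.mem_image.1 hS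
        refine ⟨⟨ψ.symm, fun {x y} hxy => ?_⟩, ψ.symm.injective⟩
        rw [SimpleGraph.fromEdgeSet_adj]
        refine ⟨hSW (SimpleGraph.mem_edgeFinset.2 ?_), fun h => hxy.ne (ψ.symm.injective h)⟩
        simpa using hxy
      rw [if_pos hW, if_pos hcopy]; norm_num
    · rw [if_neg hW]
      split_ifs <;> norm_num
  linarith

lemma exists_pow_one_sub_eq {P : ℝ} (hP₀ : 0 < P) (hP₁ : P ≤ 1) {J : ℕ} (hJ : J ≠ 0) :
    ∃ p : ℝ, 0 < p ∧ p ≤ 1 ∧ 1 - (1 - p) ^ J = P ∧ P ≤ J * p := by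
  set r := (1 - P) ^ ((J : ℝ)⁻¹) with hr
  have h1P := sub_nonneg.2 hP₁
  have hrJ : r ^ J = 1 - P := Real.rpow_inv_natCast_pow h1P hJ
  have hr₀ : 0 ≤ r := Real.rpow_nonneg h1P _
  have hr₁ : r ≤ 1 := Real.rpow_le_one h1P (by linarith) (by positivity)
  have hbern : P ≤ J * (1 - r) := by
    have := one_add_mul_le_pow (a := -(1 - r)) (by linarith) J
    rw [show 1 + -(1 - r) = r by ring, hrJ] at this
    linarith
  have hJ' : (0 : ℝ) < J := by exact_mod_cast Nat.pos_of_ne_zero hJ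
  refine ⟨1 - r, ?_, by linarith, ?_, hbern⟩
  · by_contra h
    nlinarith
  · rw [show 1 - (1 - r) = r by ring, hrJ]; ring

lemma binomExp_le_const {α : Type*} [DecidableEq α] {p : ℝ} (hp₀ : 0 ≤ p) (hp₁ : p ≤ 1)
    {X : Finset α} {f : Finset α → ℝ} {c : ℝ} (h : ∀ W ⊆ X, f W ≤ c) : binomExp p X f ≤ c :=
  (binomExp_mono hp₀ hp₁ h).trans (binomExp_const p X c).le

lemma probOf_le_one (n : ℕ) {p : ℝ} (hp₀ : 0 ≤ p) (hp₁ : p ≤ 1)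
    (P : SimpleGraph (Fin n) → Prop) : probOf n p P ≤ 1 := by
  classical
  rw [probOf_eq_binomExp]
  exact binomExp_le_const hp₀ hp₁ fun W _ => by split_ifs <;> norm_num

lemma sum_range_pow_succ_le {δ : ℝ} (h₀ : 0 ≤ δ) (h₁ : δ ≤ 1 / 2) (J : ℕ) :
    ∑ i ∈ Finset.range J, δ ^ (i + 1) ≤ 2 * δ := by
  have h : ∑ i ∈ Finset.range J, δ ^ (i + 1) ≤ 2 * δ - 2 * δ * δ ^ J := by
    induction J with
    | zero => simp
    | succ J ih =>
      rw [Finset.sum_range_succ]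
      have : 0 ≤ δ ^ (J + 1) * (1 - 2 * δ) := mul_nonneg (by positivity) (by linarith)
      have hJ : δ ^ (J + 1) = δ * δ ^ J := pow_succ' δ J
      nlinarith
  have : 0 ≤ 2 * δ * δ ^ J := by positivity
  linarith

lemma log_sq_lt_self {s : ℝ} (hs : 1 ≤ s) : Real.log (s ^ 2) < s := by
  have h := Real.log_le_sub_one_of_pos (x := s / 2) (by linarith)
  rw [Real.log_div (by linarith) (by norm_num)] at h
  have := Real.log_two_lt_d9
  rw [Real.log_pow]
  push_cast
  linarith

lemma natLog_two_succ_le {s : ℕ} (hs : 1 ≤ Real.log ((s : ℝ) ^ 2)) :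
    ((Nat.log 2 (s ^ 4) + 1 : ℕ) : ℝ) ≤ 4 * Real.log ((s : ℝ) ^ 2) := by
  have h := Real.natLog_le_logb (s ^ 4) 2
  have h2 := Real.log_two_gt_d9
  rw [Real.logb, le_div_iff₀ (by push_cast; linarith)] at h
  push_cast at h ⊢
  rw [show (s : ℝ) ^ 4 = ((s : ℝ) ^ 2) ^ 2 by ring, Real.log_pow] at h
  push_cast at h
  have h0 : (0 : ℝ) ≤ (Nat.log 2 (s ^ 4) : ℝ) := by positivity
  nlinarith

/-- A quantitative form of the theorem. -/
lemma one_sub_le_probOf_comb_log (s : ℕ) (hs : 0 < s)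
    (hlog : 128 * Real.exp 1 ^ 2 ≤ Real.log ((s : ℝ) ^ 2)) :
    1 - 128 * Real.exp 1 ^ 2 / Real.log ((s : ℝ) ^ 2)
      ≤ probOf (s ^ 2) (Real.log ((s : ℝ) ^ 2) ^ 2 / (s : ℝ) ^ 2)
        (fun G => ContainsCopy (comb s s) G) := by
  set L := Real.log ((s : ℝ) ^ 2) with hL
  have hs' : (1 : ℝ) ≤ s := by exact_mod_cast hs
  have he : 1 ≤ Real.exp 1 ^ 2 := one_le_pow₀ (Real.one_le_exp zero_le_one)
  have hL0 : 0 < L := by linarith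
  have hLs : L < s := log_sq_lt_self hs'
  set J := Nat.log 2 (s ^ 4) + 1 with hJ
  have hJL : (J : ℝ) ≤ 4 * L := natLog_two_succ_le (by linarith)
  have hchoose : (s ^ 2).choose 2 < 2 ^ J :=
    calc (s ^ 2).choose 2 ≤ (s ^ 2) ^ 2 := Nat.choose_le_pow _ _
      _ = s ^ 4 := by ring
      _ < 2 ^ J := Nat.lt_pow_succ_log_self one_lt_two _
  obtain ⟨p, hp, hp₁, hpJ, hPp⟩ := exists_pow_one_sub_eq (P := L ^ 2 / (s : ℝ) ^ 2)
    (by positivity) (div_le_one_of_le₀ (by gcongr) (by positivity)) (Nat.succ_ne_zero _ : J ≠ 0)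
  have hpL : L ≤ 4 * (p * (s : ℝ) ^ 2) := by
    rw [div_le_iff₀ (by positivity)] at hPp
    have : J * p * (s : ℝ) ^ 2 ≤ 4 * L * (p * (s : ℝ) ^ 2) := by
      rw [mul_assoc]; gcongr
    exact le_of_mul_le_mul_left (by nlinarith) hL0
  have hδ : 4 * (4 * Real.exp 1 ^ 2 / (s : ℝ) ^ 2 / p) ≤ 64 * Real.exp 1 ^ 2 / L := by
    rw [div_div, ← mul_div_assoc, div_le_div_iff₀ (by positivity) hL0]
    nlinarith
  have hδ' : 64 * Real.exp 1 ^ 2 / L ≤ 1 / 2 := by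
    rw [div_le_iff₀ hL0]; linarith
  have hmain := one_sub_le_probOf_comb s J hs hp hp₁ (by linarith) hchoose
  rw [hpJ] at hmain
  have hsum := sum_range_pow_succ_le (δ := 4 * (4 * Real.exp 1 ^ 2 / (s : ℝ) ^ 2 / p))
    (by positivity) (by linarith) J
  have : 128 * Real.exp 1 ^ 2 / L = 2 * (64 * Real.exp 1 ^ 2 / L) := by ring
  linarith

end Comb

/-- If `√n ∈ ℕ` (i.e. `n = s²`), then almost surely `G(n, log²n/n)` contains a copy of
`Comb_{n,√n}` (here `Comb_{s²,s}` is a graph on `Fin s × Fin s`, which has `s²` vertices). -/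
theorem stmt15 :
    Filter.Tendsto
      (fun s : ℕ => probOf (s ^ 2) ((Real.log (s ^ 2)) ^ 2 / (s ^ 2))
        (fun G => ContainsCopy (comb s s) G))
      Filter.atTop (nhds 1) := by
  have hlog : Filter.Tendsto (fun s : ℕ => Real.log ((s : ℝ) ^ 2)) Filter.atTop Filter.atTop :=
    Real.tendsto_log_atTop.comp
      ((Filter.tendsto_pow_atTop two_ne_zero).comp tendsto_natCast_atTop_atTop)
  have hlower : Filter.Tendsto (fun s : ℕ => 1 - 128 * Real.exp 1 ^ 2 / Real.log ((s : ℝ) ^ 2))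
      Filter.atTop (nhds 1) := by
    have h := (hlog.const_div_atTop (128 * Real.exp 1 ^ 2)).const_sub 1
    rwa [sub_zero] at h
  refine tendsto_of_tendsto_of_tendsto_of_le_of_le' hlower tendsto_const_nhds ?_ ?_
  · filter_upwards [hlog.eventually_ge_atTop (128 * Real.exp 1 ^ 2),
      Filter.eventually_gt_atTop 0] with s hs hs0
    exact one_sub_le_probOf_comb_log s hs0 hs
  · filter_upwards [hlog.eventually_ge_atTop 0, Filter.eventually_gt_atTop 0] with s hs hs0
    have hs1 : (1 : ℝ) ≤ s := by exact_mod_cast hs0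
    exact probOf_le_one _ (by positivity)
      (div_le_one_of_le₀ (pow_le_pow_left₀ hs (log_sq_lt_self hs1).le 2) (by positivity)) _
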